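/- Let φ be a nonlinear bound state, γ > 1, and let v₀ ∈ H¹₀(Ω) generate the linearized iteration v_{n+1} = 𝓐′(φ)v_n, where 𝓐′(φ)h = 𝓛⁻¹(p|φ|^{p−1}h) − γ(p−1)(⟨φ,h⟩_{H¹}/‖φ‖²_{H¹}) φ. Define a_n = ⟨φ, v_n⟩_{H¹}/⟨φ,φ⟩_{H¹} and w_n = v_n − a_n φ. Then w_n is H¹-orthogonal to φ for every n, and the components satisfy the decoupled recursions w_{n+1} = 𝓛⁻¹(p|φ|^{p−1} w_n) and a_{n+1} = (p − γ(p−1)) a_n. -/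

import Mathlib

open scoped RealInnerProductSpace
open Filter Topology

/-- Abstract model of the setting of the paper: `H` plays the role of the Sobolev
space `H¹₀(Ω)` for a bounded, convex, open set `Ω ⊆ ℝ^d`, equipped with the `H¹`
inner product `⟪f, g⟫_{H¹} = ∫_Ω (f g + ∇f ⬝ ∇g)`.

* `lpNorm u` is the `L^{p+1}(Ω)` norm `‖u‖_{L^{p+1}}` (finite by the Sobolev
  embedding, since `p` is subcritical);
* `tri φ h v` is the `L²(Ω)` pairing `∫_Ω |φ|^{p-1} h v`, so that
  `tri u u v = ∫_Ω |u|^{p-1} u v` and `tri u u u = ‖u‖_{L^{p+1}}^{p+1}`;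
* `N u` is `𝓛⁻¹(|u|^{p-1} u)`, where `𝓛 = I - Δ` with homogeneous Dirichlet
  boundary conditions, characterized by `⟪N u, v⟫_{H¹} = ∫_Ω |u|^{p-1} u v`;
* `Tlin φ` is the bounded linear operator `h ↦ 𝓛⁻¹(p |φ|^{p-1} h)`,
  characterized by `⟪Tlin φ h, v⟫_{H¹} = p ∫_Ω |φ|^{p-1} h v`. -/
structure PetviashviliSetting (d : ℕ) (p : ℝ) where
  /-- The underlying domain `Ω ⊆ ℝ^d`: a bounded, convex, open, nonempty set. -/
  Ω : Set (EuclideanSpace ℝ (Fin d))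
  isOpen_Ω : IsOpen Ω
  convex_Ω : Convex ℝ Ω
  isBounded_Ω : Bornology.IsBounded Ω
  nonempty_Ω : Ω.Nonempty
  /-- The Sobolev space `H¹₀(Ω)`, a real Hilbert space for the `H¹` inner product. -/
  H : Type
  [grp : NormedAddCommGroup H]
  [ips : InnerProductSpace ℝ H]
  [cpl : CompleteSpace H]
  /-- `‖u‖_{L^{p+1}(Ω)}`. -/
  lpNorm : H → ℝ
  /-- `tri φ h v = ∫_Ω |φ|^{p-1} h v`. -/
  tri : H → H → H → ℝ
  /-- `N u = 𝓛⁻¹(|u|^{p-1} u)`. -/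
  N : H → H
  /-- `Tlin φ h = 𝓛⁻¹(p |φ|^{p-1} h)`. -/
  Tlin : H → H →L[ℝ] H
  lpNorm_zero : lpNorm 0 = 0
  lpNorm_pos : ∀ u, u ≠ 0 → 0 < lpNorm u
  tri_symm : ∀ φ h v, tri φ h v = tri φ v h
  tri_self : ∀ u, tri u u u = lpNorm u ^ (p + 1)
  N_spec : ∀ u v, ⟪N u, v⟫ = tri u u v
  Tlin_spec : ∀ φ h v, ⟪Tlin φ h, v⟫ = p * tri φ h v

attribute [instance] PetviashviliSetting.grp PetviashviliSetting.ips PetviashviliSetting.cpl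

namespace PetviashviliSetting

variable {d : ℕ} {p : ℝ}

/-- `M[u] = ‖u‖²_{H¹} / ‖u‖_{L^{p+1}}^{p+1}`. -/
noncomputable def M (S : PetviashviliSetting d p) (u : S.H) : ℝ :=
  ‖u‖ ^ 2 / S.lpNorm u ^ (p + 1)

/-- The Petviashvili iteration operator `𝓐(u) = M[u]^γ 𝓛⁻¹(|u|^{p-1} u)`. -/
noncomputable def A (S : PetviashviliSetting d p) (γ : ℝ) (u : S.H) : S.H :=
  S.M u ^ γ • S.N u

/-- `φ` is a nonlinear bound state: a nontrivial weak solution of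
`-φ + Δφ + |φ|^{p-1}φ = 0`, i.e. `∫_Ω (∇φ⬝∇v + φ v) = ∫_Ω |φ|^{p-1}φ v` for all
`v ∈ H¹₀(Ω)`. -/
def IsBoundState (S : PetviashviliSetting d p) (φ : S.H) : Prop :=
  φ ≠ 0 ∧ ∀ v : S.H, ⟪φ, v⟫ = S.tri φ φ v

end PetviashviliSetting

/-- The nonlinearity is superlinear and subcritical: `1 < p < d†`, where
`d† = ∞` for `d = 1, 2` and `d† = (d+2)/(d-2)` for `d ≥ 3`. -/
def Subcritical (d : ℕ) (p : ℝ) : Prop :=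
  1 < p ∧ (3 ≤ d → p < ((d : ℝ) + 2) / ((d : ℝ) - 2))

/-- `γ` is admissible: `1 < γ < (p+1)/(p-1)`. -/
def Admissible (p γ : ℝ) : Prop := 1 < γ ∧ γ < (p + 1) / (p - 1)

/-- The linearization of the Petviashvili operator at a bound state `φ`:
`𝓐′(φ)h = 𝓛⁻¹(p|φ|^{p-1}h) - γ(p-1)(⟪φ,h⟫_{H¹}/‖φ‖²_{H¹}) φ`. -/
noncomputable def PetviashviliSetting.Aprime {d : ℕ} {p : ℝ}
    (S : PetviashviliSetting d p) (γ : ℝ) (φ : S.H) : S.H →L[ℝ] S.H :=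
  S.Tlin φ - (γ * (p - 1) / ‖φ‖ ^ 2) • (innerSL ℝ φ).smulRight φ

namespace PetviashviliSetting

variable {d : ℕ} {p : ℝ} {S : PetviashviliSetting d p} {φ : S.H}

/-- A bound state is an eigenvector of `h ↦ 𝓛⁻¹(p|φ|^{p-1}h)` with eigenvalue `p`. -/
theorem IsBoundState.Tlin_self (hφ : S.IsBoundState φ) : S.Tlin φ φ = p • φ :=
  ext_inner_right ℝ fun v => by
    rw [S.Tlin_spec, real_inner_smul_left, hφ.2 v]

theorem IsBoundState.inner_Tlin (hφ : S.IsBoundState φ) (h : S.H) :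
    ⟪φ, S.Tlin φ h⟫ = p * ⟪φ, h⟫ := by
  rw [real_inner_comm, S.Tlin_spec, S.tri_symm, hφ.2 h]

theorem Aprime_apply (S : PetviashviliSetting d p) (γ : ℝ) (φ h : S.H) :
    S.Aprime γ φ h = S.Tlin φ h - (γ * (p - 1) * (⟪φ, h⟫ / ⟪φ, φ⟫)) • φ := by
  simp only [Aprime, _root_.sub_apply, _root_.smul_apply,
    ContinuousLinearMap.smulRight_apply, innerSL_apply_apply, smul_smul,
    real_inner_self_eq_norm_sq]
  congr 2
  ring

end PetviashviliSetting

/-- Let `φ` be a nonlinear bound state, `γ > 1`, and let `v₀ ∈ H¹₀(Ω)`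
generate the linearized iteration `v_{n+1} = 𝓐′(φ)v_n`.  Define
`a_n = ⟪φ, v_n⟫_{H¹}/⟪φ,φ⟫_{H¹}` and `w_n = v_n - a_n φ`.  Then `w_n` is
`H¹`-orthogonal to `φ` for every `n`, and the components satisfy the decoupled
recursions `w_{n+1} = 𝓛⁻¹(p|φ|^{p-1} w_n)` and `a_{n+1} = (p - γ(p-1)) a_n`. -/
theorem linearized_iteration_decomposition {d : ℕ} {p : ℝ}
    (S : PetviashviliSetting d p) (hp : Subcritical d p) (γ : ℝ) (hγ : 1 < γ)
    (φ : S.H) (hφ : S.IsBoundState φ)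
    (v : ℕ → S.H) (hv : ∀ n, v (n + 1) = S.Aprime γ φ (v n))
    (a : ℕ → ℝ) (ha : ∀ n, a n = ⟪φ, v n⟫ / ⟪φ, φ⟫)
    (w : ℕ → S.H) (hw : ∀ n, w n = v n - a n • φ) :
    (∀ n, ⟪w n, φ⟫ = (0 : ℝ)) ∧
    (∀ n, w (n + 1) = S.Tlin φ (w n)) ∧
    (∀ n, a (n + 1) = (p - γ * (p - 1)) * a n) := by
  have hφφ : ⟪φ, φ⟫ ≠ 0 := inner_self_ne_zero.mpr hφ.1
  have hstep : ∀ n, v (n + 1) = S.Tlin φ (v n) - (γ * (p - 1) * a n) • φ := fun n => by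
    rw [hv, S.Aprime_apply, ha]
  have hinner : ∀ n, ⟪φ, v n⟫ = a n * ⟪φ, φ⟫ := fun n => by
    rw [ha, div_mul_cancel₀ _ hφφ]
  have hrec : ∀ n, a (n + 1) = (p - γ * (p - 1)) * a n := fun n => by
    rw [ha (n + 1), div_eq_iff hφφ, hstep, inner_sub_right, hφ.inner_Tlin,
      real_inner_smul_right, hinner]
    ring
  refine ⟨fun n => ?_, fun n => ?_, hrec⟩
  · rw [hw, real_inner_comm, inner_sub_right, real_inner_smul_right, hinner, sub_self]
  · rw [hw, hw, hstep, hrec, map_sub, map_smul, hφ.Tlin_self]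
    module
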